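/- arXiv:2102.02483 — 11 statements merged into one kernel-verified Lean document; each statement's English description precedes it below -/
import Mathlib

section
/- Let X be a set equipped with two topologies τ0 and τ1, and let Y, Z ⊆ X. Then the co-derived set of (Yᶜ ∪ Z) with respect to τ0 is contained in e_{τ0,τ1}(Y, Z); equivalently, the complement of d_{τ0}(Y ∩ Zᶜ) is a subset of e_{τ0,τ1}(Y, Z). (This expresses the validity of the axiom J1: □(p → q) → (p ▷ q) in every bitopological space.) -/
/-- The derived set of `Y` with respect to the topology `τ`. -/
def dSet {X : Type*} (τ : TopologicalSpace X) (Y : Set X) : Set X :=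
  {x | ∀ U : Set X, τ.IsOpen U → x ∈ U → ∃ y, y ≠ x ∧ y ∈ Y ∩ U}

/-- The co-derived set of `Y` with respect to the topology `τ`. -/
def cdSet {X : Type*} (τ : TopologicalSpace X) (Y : Set X) : Set X :=
  (dSet τ Yᶜ)ᶜ

/-- The operation `e_{τ0,τ1}` on a bitopological space. -/
def eSet {X : Type*} (τ0 τ1 : TopologicalSpace X) (Y Z : Set X) : Set X :=
  {x | ∀ U : Set X, τ1.IsOpen U → x ∈ dSet τ0 (Y ∩ U) → x ∈ dSet τ0 (Z ∩ U)}

/-- Validity of axiom J1 in every bitopological space: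
`cd_{τ0}(Yᶜ ∪ Z) ⊆ e_{τ0,τ1}(Y, Z)`. -/
theorem J1_valid {X : Type*} (τ0 τ1 : TopologicalSpace X) (Y Z : Set X) :
    cdSet τ0 (Yᶜ ∪ Z) ⊆ eSet τ0 τ1 Y Z := by
  intro x hx U _ hY W hW hxW
  have hx' : ¬ ∀ V : Set X, τ0.IsOpen V → x ∈ V → ∃ y, y ≠ x ∧ y ∈ (Yᶜ ∪ Z)ᶜ ∩ V := hx
  push Not at hx'
  obtain ⟨V, hV, hxV, hVZ⟩ := hx'
  obtain ⟨y, hyx, ⟨hyY, hyU⟩, hyW, hyV⟩ := hY (W ∩ V) (τ0.isOpen_inter W V hW hV) ⟨hxW, hxV⟩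
  have hyZ : y ∈ Z := by
    by_contra hyZ
    exact hVZ y hyx ⟨fun h => h.elim (fun h => h hyY) hyZ, hyV⟩
  exact ⟨y, hyx, ⟨hyZ, hyU⟩, hyW⟩
end

section
/- Let X be a set equipped with two topologies τ0 and τ1, and let Y, Z, W ⊆ X. Then e_{τ0,τ1}(Y, W) ∩ e_{τ0,τ1}(Z, W) ⊆ e_{τ0,τ1}(Y ∪ Z, W). (This expresses the validity of the axiom J3: (p ▷ r) ∧ (q ▷ r) → ((p ∨ q) ▷ r) in every bitopological space.) -/
/-- The derived set of a union is contained in the union of the derived sets. -/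
theorem dSet_union_subset {X : Type*} (τ : TopologicalSpace X) (Y Z : Set X) :
    dSet τ (Y ∪ Z) ⊆ dSet τ Y ∪ dSet τ Z := by
  intro x hx
  by_contra h
  simp only [dSet, Set.mem_union, Set.mem_ofPred_eq, not_or, not_forall] at h
  obtain ⟨⟨A, hA, hxA, hYA⟩, B, hB, hxB, hZB⟩ := h
  obtain ⟨y, hne, hy | hy, hyA, hyB⟩ := hx (A ∩ B) (τ.isOpen_inter A B hA hB) ⟨hxA, hxB⟩
  · exact hYA ⟨y, hne, hy, hyA⟩
  · exact hZB ⟨y, hne, hy, hyB⟩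

/-- Validity of axiom J3 in every bitopological space:
`e_{τ0,τ1}(Y, W) ∩ e_{τ0,τ1}(Z, W) ⊆ e_{τ0,τ1}(Y ∪ Z, W)`. -/
theorem J3_valid {X : Type*} (τ0 τ1 : TopologicalSpace X) (Y Z W : Set X) :
    eSet τ0 τ1 Y W ∩ eSet τ0 τ1 Z W ⊆ eSet τ0 τ1 (Y ∪ Z) W := by
  rintro x ⟨hY, hZ⟩ U hU hx
  rw [Set.union_inter_distrib_right] at hx
  exact (dSet_union_subset τ0 _ _ hx).elim (hY U hU) (hZ U hU)
end

section
/- Let W be a set, R a binary relation on W, and S a reflexive and transitive binary relation on W. Write R(x) := {y ∈ W | x R y} and S(y) := {z ∈ W | y S z}, and call U ⊆ W S-upward closed if y ∈ U and y S z imply z ∈ U. Then for every x ∈ W and all subsets A, B ⊆ W, the following are equivalent: (i) for every y ∈ R(x) ∩ A, the set R(x) ∩ S(y) ∩ B is nonempty; (ii) for every S-upward closed set U, if R(x) ∩ A ∩ U is nonempty then R(x) ∩ U ∩ B is nonempty. -/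
/-- Key equivalence between the Visser-style satisfaction clause for `▷` and the
bitopological clause using the topology of `S`-upward closed sets. -/
theorem visser_clause_equiv {W : Type*} (R S : W → W → Prop)
    (hSrefl : ∀ x, S x x) (hStrans : ∀ x y z, S x y → S y z → S x z)
    (x : W) (A B : Set W) :
    (∀ y, R x y → y ∈ A → ∃ z, R x z ∧ S y z ∧ z ∈ B) ↔
      (∀ U : Set W, (∀ y ∈ U, ∀ z, S y z → z ∈ U) →
        (∃ y, R x y ∧ y ∈ A ∧ y ∈ U) → ∃ z, R x z ∧ z ∈ U ∧ z ∈ B) := by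
  constructor
  · rintro h U hU ⟨y, hxy, hyA, hyU⟩
    obtain ⟨z, hxz, hyz, hzB⟩ := h y hxy hyA
    exact ⟨z, hxz, hU y hyU z hyz, hzB⟩
  · intro h y hxy hyA
    exact h {z | S y z} (fun u hu z huz => hStrans y u z hu huz) ⟨y, hxy, hyA, hSrefl y⟩
end

section
/- Let X be a nonempty set equipped with two topologies τ0 and τ1. Then the following are equivalent: (1) ⟨X, τ0⟩ is scattered and both τ0 and τ1 are Alexandroff; (2) there exist binary relations R and S on X such that R is transitive and conversely well-founded (i.e. the converse relation of R is well-founded), S is reflexive and transitive, τ0 is exactly the collection of R-upward closed subsets of X, and τ1 is exactly the collection of S-upward closed subsets of X. -/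
/-- A topological space is scattered if every nonempty subset `Y` satisfies
`Y \ d_τ(Y) ≠ ∅`. -/
def IsScattered {X : Type*} (τ : TopologicalSpace X) : Prop :=
  ∀ Y : Set X, Y.Nonempty → (Y \ dSet τ Y).Nonempty

/-- A topology is Alexandroff if arbitrary intersections of open sets are open. -/
def IsAlexandroff {X : Type*} (τ : TopologicalSpace X) : Prop :=
  ∀ S : Set (Set X), (∀ U ∈ S, τ.IsOpen U) → τ.IsOpen (⋂₀ S)

/-- `U` is upward closed with respect to the relation `P`. -/
def UpClosed {X : Type*} (P : X → X → Prop) (U : Set X) : Prop :=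
  ∀ x ∈ U, ∀ y, P x y → y ∈ U

/-- Every open set containing `x` contains `y`. -/
def OpenLE {X : Type*} (τ : TopologicalSpace X) (x y : X) : Prop :=
  ∀ U : Set X, τ.IsOpen U → x ∈ U → y ∈ U

theorem IsAlexandroff.isOpen_iff_upClosed {X : Type*} {τ : TopologicalSpace X}
    (h : IsAlexandroff τ) (U : Set X) : τ.IsOpen U ↔ UpClosed (OpenLE τ) U := by
  refine ⟨fun hU x hx y hxy => hxy U hU hx, fun hU => ?_⟩
  have key : U = ⋃₀ {V | τ.IsOpen V ∧ V ⊆ U} := by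
    refine Set.Subset.antisymm (fun x hx => ?_) (Set.sUnion_subset fun V hV => hV.2)
    refine ⟨⋂₀ {V | τ.IsOpen V ∧ x ∈ V}, ⟨h _ fun V hV => hV.1, fun y hy => ?_⟩,
      fun V hV => hV.2⟩
    exact hU x hx y fun V hV hxV => hy V ⟨hV, hxV⟩
  rw [key]
  exact τ.isOpen_sUnion _ fun V hV => hV.1

theorem isAlexandroff_of_isOpen_iff_upClosed {X : Type*} {τ : TopologicalSpace X}
    {P : X → X → Prop} (h : ∀ U : Set X, τ.IsOpen U ↔ UpClosed P U) : IsAlexandroff τ :=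
  fun _ hS => (h _).2 fun x hx y hxy U hU => (h U).1 (hS U hU) x (hx U hU) y hxy

theorem upClosed_and_ne_iff {X : Type*} (P : X → X → Prop) (U : Set X) :
    UpClosed (fun x y => P x y ∧ x ≠ y) U ↔ UpClosed P U := by
  refine ⟨fun h x hx y hxy => ?_, fun h x hx y hxy => h x hx y hxy.1⟩
  by_cases hne : x = y
  · exact hne ▸ hx
  · exact h x hx y ⟨hxy, hne⟩

/-- In a scattered space every nonempty set has an element with no other element of the set
in all of its open neighborhoods. -/
theorem IsScattered.exists_maximal {X : Type*} {τ : TopologicalSpace X} (h : IsScattered τ)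
    (Y : Set X) (hY : Y.Nonempty) : ∃ m ∈ Y, ∀ y ∈ Y, OpenLE τ m y → m = y := by
  obtain ⟨m, hm, hd⟩ := h Y hY
  refine ⟨m, hm, fun y hy hmy => ?_⟩
  by_contra hne
  exact hd fun U hU hmU => ⟨y, Ne.symm hne, hy, hmy U hU hmU⟩

theorem IsScattered.openLE_antisymm {X : Type*} {τ : TopologicalSpace X} (h : IsScattered τ)
    {x y : X} (hxy : OpenLE τ x y) (hyx : OpenLE τ y x) : x = y := by
  obtain ⟨m, rfl | rfl, hm⟩ := h.exists_maximal {x, y} ⟨x, Or.inl rfl⟩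
  · exact hm y (Or.inr rfl) hxy
  · exact (hm x (Or.inl rfl) hyx).symm

theorem isScattered_of_isOpen_iff_upClosed {X : Type*} {τ : TopologicalSpace X}
    {R : X → X → Prop} (hR : ∀ x y z, R x y → R y z → R x z)
    (hwf : WellFounded (fun a b => R b a))
    (h : ∀ U : Set X, τ.IsOpen U ↔ UpClosed R U) : IsScattered τ := by
  intro Y hY
  obtain ⟨m, hm, hmin⟩ := hwf.has_min Y hY
  refine ⟨m, hm, fun hd => ?_⟩
  have hU : τ.IsOpen {y | y = m ∨ R m y} := by
    refine (h _).2 ?_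
    rintro x (rfl | hx) y hxy
    · exact Or.inr hxy
    · exact Or.inr (hR _ _ _ hx hxy)
  obtain ⟨y, hne, hy, hym⟩ := hd _ hU (Or.inl rfl)
  exact hmin y hy (hym.resolve_left hne)

/-- A bitopological space on a nonempty set `X` has `τ0` scattered and `τ0, τ1`
Alexandroff iff it arises from a Visser frame, i.e. there are relations `R` (transitive
and conversely well-founded) and `S` (reflexive and transitive) on `X` such that `τ0`
consists exactly of the `R`-upward closed sets and `τ1` of the `S`-upward closed sets. -/
theorem alexandroff_scattered_iff_visser {X : Type*} [Nonempty X]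
    (τ0 τ1 : TopologicalSpace X) :
    (IsScattered τ0 ∧ IsAlexandroff τ0 ∧ IsAlexandroff τ1) ↔
      (∃ R S : X → X → Prop,
        Transitive R ∧ WellFounded (fun a b => R b a) ∧
        (∀ x, S x x) ∧ Transitive S ∧
        (∀ U : Set X, τ0.IsOpen U ↔ UpClosed R U) ∧
        (∀ U : Set X, τ1.IsOpen U ↔ UpClosed S U)) := by
  constructor
  · rintro ⟨hs, h0, h1⟩
    refine ⟨fun x y => OpenLE τ0 x y ∧ x ≠ y, OpenLE τ1, ?_, ?_, fun x U _ hx => hx,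
      fun x y z hxy hyz U hU hx => hyz U hU (hxy U hU hx),
      fun U => (h0.isOpen_iff_upClosed U).trans (upClosed_and_ne_iff _ U).symm,
      h1.isOpen_iff_upClosed⟩
    · rintro x y z ⟨hxy, hne⟩ ⟨hyz, -⟩
      refine ⟨fun U hU hx => hyz U hU (hxy U hU hx), ?_⟩
      rintro rfl
      exact hne (hs.openLE_antisymm hxy hyz)
    · refine WellFounded.wellFounded_iff_has_min.2 fun Y hY => ?_
      obtain ⟨m, hm, hmax⟩ := hs.exists_maximal Y hY
      exact ⟨m, hm, fun y hy hmy => hmy.2 (hmax y hy hmy.1)⟩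
  · rintro ⟨R, S, hR, hwf, -, -, h0, h1⟩
    exact ⟨isScattered_of_isOpen_iff_upClosed (R := R) (fun _ _ _ hxy hyz => hR hxy hyz) hwf h0,
      isAlexandroff_of_isOpen_iff_upClosed h0, isAlexandroff_of_isOpen_iff_upClosed h1⟩
end

section
/- Let X be a set equipped with two topologies τ0 and τ1 such that ⟨X, τ0⟩ is scattered. Then the following are equivalent: (a) for every U ∈ τ1 and every Y ⊆ X, d_{τ0}(d_{τ0}(Y) ∩ U) ⊆ d_{τ0}(Y ∩ U); (b) for every U ∈ τ1, d_{τ0}(d_{τ0}(Uᶜ) ∩ U) = ∅. -/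
theorem dSet_empty {X : Type*} (τ : TopologicalSpace X) : dSet τ ∅ = ∅ := by
  ext x
  refine ⟨fun h => ?_, fun h => h.elim⟩
  obtain ⟨y, -, hy, -⟩ := h Set.univ τ.isOpen_univ trivial
  exact hy

theorem dSet_mono {X : Type*} (τ : TopologicalSpace X) {Y Z : Set X} (h : Y ⊆ Z) :
    dSet τ Y ⊆ dSet τ Z := fun _ hx U hU hxU =>
  let ⟨y, hne, hy, hyU⟩ := hx U hU hxU
  ⟨y, hne, h hy, hyU⟩

/-- In a scattered space every derived set is closed under limit points. -/
theorem IsScattered.dSet_dSet_subset {X : Type*} {τ : TopologicalSpace X}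
    (hsc : IsScattered τ) (Z : Set X) : dSet τ (dSet τ Z) ⊆ dSet τ Z := by
  intro x hx V hV hxV
  by_contra! hcon
  obtain ⟨y, hy, hyd⟩ := hsc (insert x (V ∩ dSet τ Z)) ⟨x, Set.mem_insert _ _⟩
  apply hyd
  intro W hW hyW
  by_cases hyx : y = x
  · subst hyx
    obtain ⟨z, hne, hz, hzW, hzV⟩ := hx (W ∩ V) (τ.isOpen_inter W V hW hV) ⟨hyW, hxV⟩
    exact ⟨z, hne, Or.inr ⟨hzV, hz⟩, hzW⟩
  · obtain ⟨hyV, hyZ⟩ := hy.resolve_left hyx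
    obtain ⟨z, hne, hz, hzW, hzV⟩ := hyZ (W ∩ V) (τ.isOpen_inter W V hW hV) ⟨hyW, hyV⟩
    have hzx : z = x := by
      by_contra hzx
      exact hcon z hzx ⟨hz, hzV⟩
    exact ⟨z, hne, Or.inl hzx, hzW⟩

/-- Equivalence of conditions (a) and (b) of the characterization of IL-spaces. -/
theorem IL_char_a_iff_b {X : Type*} (τ0 τ1 : TopologicalSpace X)
    (hsc : IsScattered τ0) :
    (∀ U : Set X, τ1.IsOpen U → ∀ Y : Set X,
        dSet τ0 (dSet τ0 Y ∩ U) ⊆ dSet τ0 (Y ∩ U)) ↔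
      (∀ U : Set X, τ1.IsOpen U → dSet τ0 (dSet τ0 Uᶜ ∩ U) = ∅) := by
  constructor
  · intro ha U hU
    have h := ha U hU Uᶜ
    rwa [Set.compl_inter_self, dSet_empty, Set.subset_empty_iff] at h
  · intro hb U hU Y
    have hY : dSet τ0 Y ⊆ dSet τ0 (Y ∩ U) ∪ dSet τ0 Uᶜ :=
      (dSet_mono τ0 fun y hy => (em (y ∈ U)).imp (⟨hy, ·⟩) id).trans (dSet_union_subset τ0 _ _)
    have hYU : dSet τ0 Y ∩ U ⊆ dSet τ0 (Y ∩ U) ∪ dSet τ0 Uᶜ ∩ U :=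
      fun y hy => (hY hy.1).imp_right (⟨·, hy.2⟩)
    have h := (dSet_mono τ0 hYU).trans (dSet_union_subset τ0 _ _)
    rw [hb U hU, Set.union_empty] at h
    exact h.trans (hsc.dSet_dSet_subset _)
end

section
/- Let X be a set equipped with two topologies τ0 and τ1 such that ⟨X, τ0⟩ is scattered. Then the following are equivalent: (b) for every U ∈ τ1, d_{τ0}(d_{τ0}(Uᶜ) ∩ U) = ∅; (c) for every U ∈ τ1 there exists V ∈ τ0 such that V ⊆ U and d_{τ0}(U \ V) = ∅. -/
/-- An open subset of `U` contains no limit point of the complement of `U`. -/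
theorem dSet_compl_inter_subset_diff {X : Type*} (τ : TopologicalSpace X) {U V : Set X}
    (hV : τ.IsOpen V) (hVU : V ⊆ U) : dSet τ Uᶜ ∩ U ⊆ U \ V := by
  rintro x ⟨hx, hxU⟩
  refine ⟨hxU, fun hxV => ?_⟩
  obtain ⟨y, -, hyU, hyV⟩ := hx V hV hxV
  exact hyU (hVU hyV)

theorem diff_interior_subset_dSet_compl_inter {X : Type*} (τ : TopologicalSpace X) (U : Set X) :
    U \ interior U ⊆ dSet τ Uᶜ ∩ U := by
  rintro x ⟨hxU, hxV⟩
  refine ⟨fun W hW hxW => ?_, hxU⟩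
  have hWU : ¬ W ⊆ U := fun h => hxV (mem_interior.2 ⟨W, h, hW, hxW⟩)
  obtain ⟨y, hyW, hyU⟩ := Set.not_subset.1 hWU
  exact ⟨y, fun h => hyU (h ▸ hxU), hyU, hyW⟩

/-- Equivalence of conditions (b) and (c) of the characterization of IL-spaces. -/
theorem IL_char_b_iff_c {X : Type*} (τ0 τ1 : TopologicalSpace X)
    (hsc : IsScattered τ0) :
    (∀ U : Set X, τ1.IsOpen U → dSet τ0 (dSet τ0 Uᶜ ∩ U) = ∅) ↔
      (∀ U : Set X, τ1.IsOpen U →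
        ∃ V : Set X, τ0.IsOpen V ∧ V ⊆ U ∧ dSet τ0 (U \ V) = ∅) := by
  refine forall₂_congr fun U _ => ⟨fun h => ?_, ?_⟩
  · exact ⟨@interior X τ0 U, @isOpen_interior X τ0 U, @interior_subset X τ0 U,
      Set.subset_eq_empty (dSet_mono τ0 (diff_interior_subset_dSet_compl_inter τ0 U)) h⟩
  · rintro ⟨V, hV, hVU, h⟩
    exact Set.subset_eq_empty (dSet_mono τ0 (dSet_compl_inter_subset_diff τ0 hV hVU)) h
end

section
/- Let ⟨X, τ⟩ be a topological space. Then τ is Alexandroff if and only if for every family {Y_i}_{i ∈ I} of subsets of X, d_τ(⋃_{i ∈ I} Y_i) ⊆ ⋃_{i ∈ I} d_τ(Y_i). -/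
universe u

/-- A topology is Alexandroff iff the derived-set operation is distributive over
arbitrary unions: `d_τ(⋃ i, Y i) ⊆ ⋃ i, d_τ(Y i)` for every family of subsets. -/
theorem alexandroff_iff_dSet_iUnion {X : Type u} (τ : TopologicalSpace X) :
    IsAlexandroff τ ↔
      ∀ (I : Type u) (Y : I → Set X), dSet τ (⋃ i, Y i) ⊆ ⋃ i, dSet τ (Y i) := by
  constructor
  · intro h I Y x hx
    by_contra hn
    have hsep : ∀ i, ∃ U : Set X, τ.IsOpen U ∧ x ∈ U ∧ ∀ y, y ≠ x → y ∉ Y i ∩ U := by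
      simpa [dSet] using hn
    choose U hU hxU hYU using hsep
    obtain ⟨y, hyx, hyY, hyU⟩ := hx (⋂₀ Set.range U)
      (h _ (Set.forall_mem_range.2 hU)) (Set.mem_sInter.2 (Set.forall_mem_range.2 hxU))
    obtain ⟨i, hi⟩ := Set.mem_iUnion.1 hyY
    exact hYU i y hyx ⟨hi, hyU _ ⟨i, rfl⟩⟩
  · intro h S hS
    refine isOpen_iff_forall_mem_open.2 fun x hx => ?_
    by_contra! hn
    have hd : x ∈ dSet τ (⋃ U : S, (U : Set X)ᶜ) := by
      intro V hV hxV
      obtain ⟨y, hyV, hyS⟩ := Set.not_subset.1 fun hVS => hn V hVS hV hxV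
      refine ⟨y, fun hyx => hyS (hyx ▸ hx), ?_, hyV⟩
      simpa using hyS
    obtain ⟨U, hU⟩ := Set.mem_iUnion.1 (h S _ hd)
    obtain ⟨y, -, hyU, hyU'⟩ := hU U (hS U U.2) (hx U U.2)
    exact hyU hyU'
end

section
/- Let X be a set equipped with two Alexandroff topologies τ0 and τ1. Define τ2 := {V ∈ τ0 | there exists U ∈ τ1 with V ⊆ U and d_{τ0}(U \ V) = ∅}. Then τ2 is an Alexandroff topology on X satisfying τ0 ∩ τ1 ⊆ τ2 ⊆ τ0. -/
/-- A collection of subsets of `X` is a topology on `X`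
(contains `X` and `∅`, closed under binary intersections and arbitrary unions). -/
def IsTopologySets {X : Type*} (T : Set (Set X)) : Prop :=
  Set.univ ∈ T ∧ (∅ : Set X) ∈ T ∧
    (∀ U V : Set X, U ∈ T → V ∈ T → U ∩ V ∈ T) ∧
    (∀ S : Set (Set X), S ⊆ T → ⋃₀ S ∈ T)

/-- The collection `τ2` built from two topologies `τ0`, `τ1`. -/
def tau2 {X : Type*} (τ0 τ1 : TopologicalSpace X) : Set (Set X) :=
  {V | τ0.IsOpen V ∧ ∃ U : Set X, τ1.IsOpen U ∧ V ⊆ U ∧ dSet τ0 (U \ V) = ∅}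

/-- In an Alexandroff topology, a set has empty derived set as soon as each of its points lies in
some set with empty derived set. -/
theorem IsAlexandroff.dSet_eq_empty {X : Type*} {τ : TopologicalSpace X} (h : IsAlexandroff τ)
    {Y : Set X} (hY : ∀ y ∈ Y, ∃ Z, y ∈ Z ∧ dSet τ Z = ∅) : dSet τ Y = ∅ := by
  refine Set.eq_empty_of_forall_notMem fun x hx => ?_
  obtain ⟨y, hyx, hyY, hyN⟩ := hx (⋂₀ {U | τ.IsOpen U ∧ x ∈ U})
    (h _ fun U hU => hU.1) (Set.mem_sInter.2 fun U hU => hU.2)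
  obtain ⟨Z, hyZ, hZ⟩ := hY y hyY
  have hxZ : x ∈ dSet τ Z := fun U hU hxU => ⟨y, hyx, hyZ, Set.mem_sInter.1 hyN U ⟨hU, hxU⟩⟩
  simp [hZ] at hxZ

theorem mem_tau2_of_isOpen {X : Type*} {τ0 τ1 : TopologicalSpace X} (h0 : IsAlexandroff τ0)
    {V : Set X} (hV0 : τ0.IsOpen V) (hV1 : τ1.IsOpen V) : V ∈ tau2 τ0 τ1 :=
  ⟨hV0, V, hV1, subset_rfl, h0.dSet_eq_empty fun _ hy => absurd hy.1 hy.2⟩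

theorem sUnion_mem_tau2 {X : Type*} {τ0 τ1 : TopologicalSpace X} (h0 : IsAlexandroff τ0)
    {S : Set (Set X)} (hS : S ⊆ tau2 τ0 τ1) : ⋃₀ S ∈ tau2 τ0 τ1 := by
  choose f hfo hf hfd using fun V : S => (hS V.2).2
  refine ⟨τ0.isOpen_sUnion S fun V hV => (hS hV).1, ⋃₀ Set.range f, ?_, ?_, ?_⟩
  · exact τ1.isOpen_sUnion _ (Set.forall_mem_range.2 hfo)
  · exact Set.sUnion_subset fun V hV =>
      (hf ⟨V, hV⟩).trans (Set.subset_sUnion_of_mem (Set.mem_range_self _))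
  · refine h0.dSet_eq_empty ?_
    rintro y ⟨⟨_, ⟨V, rfl⟩, hy⟩, hyS⟩
    exact ⟨f V \ V, ⟨hy, fun hyV => hyS ⟨V, V.2, hyV⟩⟩, hfd V⟩

theorem sInter_mem_tau2 {X : Type*} {τ0 τ1 : TopologicalSpace X} (h0 : IsAlexandroff τ0)
    (h1 : IsAlexandroff τ1) {S : Set (Set X)} (hS : S ⊆ tau2 τ0 τ1) : ⋂₀ S ∈ tau2 τ0 τ1 := by
  choose f hfo hf hfd using fun V : S => (hS V.2).2
  refine ⟨h0 S fun V hV => (hS hV).1, ⋂₀ Set.range f, ?_, ?_, ?_⟩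
  · exact h1 _ (Set.forall_mem_range.2 hfo)
  · exact Set.subset_sInter (Set.forall_mem_range.2 fun V =>
      (Set.sInter_subset_of_mem V.2).trans (hf V))
  · refine h0.dSet_eq_empty ?_
    rintro y ⟨hy, hyS⟩
    simp only [Set.mem_sInter, not_forall] at hyS
    obtain ⟨V, hV, hyV⟩ := hyS
    exact ⟨f ⟨V, hV⟩ \ V, ⟨hy _ (Set.mem_range_self _), hyV⟩, hfd ⟨V, hV⟩⟩

/-- If `τ0` and `τ1` are Alexandroff topologies on `X`, then
`τ2 := {V ∈ τ0 | ∃ U ∈ τ1, V ⊆ U ∧ d_{τ0}(U \ V) = ∅}` is an Alexandroff topology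
on `X` with `τ0 ∩ τ1 ⊆ τ2 ⊆ τ0`. -/
theorem tau2_topology {X : Type*} (τ0 τ1 : TopologicalSpace X)
    (h0 : IsAlexandroff τ0) (h1 : IsAlexandroff τ1) :
    IsTopologySets (tau2 τ0 τ1) ∧
      (∀ S : Set (Set X), S ⊆ tau2 τ0 τ1 → ⋂₀ S ∈ tau2 τ0 τ1) ∧
      (∀ V : Set X, τ0.IsOpen V → τ1.IsOpen V → V ∈ tau2 τ0 τ1) ∧
      (∀ V ∈ tau2 τ0 τ1, τ0.IsOpen V) := by
  refine ⟨⟨?_, ?_, fun U V hU hV => ?_, fun S hS => sUnion_mem_tau2 h0 hS⟩,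
    fun S hS => sInter_mem_tau2 h0 h1 hS, fun V hV0 hV1 => mem_tau2_of_isOpen h0 hV0 hV1,
    fun V hV => hV.1⟩
  · exact mem_tau2_of_isOpen h0 τ0.isOpen_univ τ1.isOpen_univ
  · simpa using sUnion_mem_tau2 h0 (Set.empty_subset (tau2 τ0 τ1))
  · simpa using sInter_mem_tau2 h0 h1 (Set.pair_subset hU hV)
end

section
/- Let X be a set equipped with two topologies τ0 and τ1 satisfying: for every U ∈ τ1 there exists V ∈ τ0 such that V ⊆ U and d_{τ0}(U \ V) = ∅. Define τ2 := {V ∈ τ0 | there exists U ∈ τ1 with V ⊆ U and d_{τ0}(U \ V) = ∅}. Then for all subsets Y, Z of X, e_{τ0,τ1}(Y, Z) = e_{τ0,τ2}(Y, Z). -/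
/-- The operation `e_{τ0,σ}` where `τ0` is a topology and `σ` is an arbitrary
collection of subsets of `X`. -/
def eSetC {X : Type*} (τ0 : TopologicalSpace X) (σ : Set (Set X)) (Y Z : Set X) :
    Set X :=
  {x | ∀ U ∈ σ, x ∈ dSet τ0 (Y ∩ U) → x ∈ dSet τ0 (Z ∩ U)}

/-- Intersecting with a subset `V ⊆ U` such that `U \ V` has no limit points does not change
derived sets. -/
theorem mem_dSet_inter_iff_of_dSet_diff_eq_empty {X : Type*} {τ : TopologicalSpace X}
    {U V : Set X} (hVU : V ⊆ U) (hd : dSet τ (U \ V) = ∅) (Y : Set X) (x : X) :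
    x ∈ dSet τ (Y ∩ U) ↔ x ∈ dSet τ (Y ∩ V) := by
  constructor
  · intro hx N hN hxN
    have hxd : x ∉ dSet τ (U \ V) := by simp [hd]
    simp only [dSet, Set.mem_ofPred_eq] at hxd
    push Not at hxd
    obtain ⟨W, hW, hxW, hWd⟩ := hxd
    obtain ⟨y, hyx, ⟨hyY, hyU⟩, hyN, hyW⟩ := hx (N ∩ W) (τ.isOpen_inter N W hN hW) ⟨hxN, hxW⟩
    have hyV : y ∈ V := by
      by_contra hyV
      exact hWd y hyx ⟨⟨hyU, hyV⟩, hyW⟩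
    exact ⟨y, hyx, ⟨hyY, hyV⟩, hyN⟩
  · intro hx N hN hxN
    obtain ⟨y, hyx, ⟨hyY, hyV⟩, hyN⟩ := hx N hN hxN
    exact ⟨y, hyx, ⟨hyY, hVU hyV⟩, hyN⟩

/-- If every `τ1`-open set `U` contains a `τ0`-open set `V` with `d_{τ0}(U \ V) = ∅`,
then `e_{τ0,τ1}(Y,Z) = e_{τ0,τ2}(Y,Z)` for all `Y, Z ⊆ X`. -/
theorem eSet_tau1_eq_tau2 {X : Type*} (τ0 τ1 : TopologicalSpace X)
    (h : ∀ U : Set X, τ1.IsOpen U →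
      ∃ V : Set X, τ0.IsOpen V ∧ V ⊆ U ∧ dSet τ0 (U \ V) = ∅) :
    ∀ Y Z : Set X,
      eSetC τ0 {U | τ1.IsOpen U} Y Z = eSetC τ0 (tau2 τ0 τ1) Y Z := by
  intro Y Z
  ext x
  constructor
  · rintro hx V ⟨-, U, hU, hVU, hd⟩ hxV
    rw [← mem_dSet_inter_iff_of_dSet_diff_eq_empty hVU hd] at hxV ⊢
    exact hx U hU hxV
  · intro hx U hU hxU
    obtain ⟨V, hV, hVU, hd⟩ := h U hU
    rw [mem_dSet_inter_iff_of_dSet_diff_eq_empty hVU hd] at hxU ⊢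
    exact hx V ⟨hV, U, hU, hVU, hd⟩ hxU
end

section
/- For any normal extension L of the conservativity logic CL, L is topologically complete if and only if L is topologically strongly complete. -/
/-- Formulas of the modal language `L(□, ▷)`. -/
inductive Fml : Type
  | var : ℕ → Fml
  | top : Fml
  | bot : Fml
  | neg : Fml → Fml
  | and : Fml → Fml → Fml
  | or : Fml → Fml → Fml
  | imp : Fml → Fml → Fml
  | box : Fml → Fml
  | dia : Fml → Fml
  | rhd : Fml → Fml → Fml
  deriving DecidableEq

/-- Classical propositional evaluation, treating formulas whose main connective is
modal (and propositional variables) as atoms. -/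
def pEval (w : Fml → Bool) : Fml → Bool
  | .var n => w (.var n)
  | .top => true
  | .bot => false
  | .neg φ => !(pEval w φ)
  | .and φ ψ => pEval w φ && pEval w ψ
  | .or φ ψ => pEval w φ || pEval w ψ
  | .imp φ ψ => !(pEval w φ) || pEval w ψ
  | .box φ => w (.box φ)
  | .dia φ => w (.dia φ)
  | .rhd φ ψ => w (.rhd φ ψ)

/-- Classical propositional tautologies of the language `L(□, ▷)`. -/
def Tautology (φ : Fml) : Prop := ∀ w : Fml → Bool, pEval w φ = true

/-- Uniform substitution. -/
def Fml.subst (σ : ℕ → Fml) : Fml → Fml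
  | .var n => σ n
  | .top => .top
  | .bot => .bot
  | .neg φ => .neg (φ.subst σ)
  | .and φ ψ => .and (φ.subst σ) (ψ.subst σ)
  | .or φ ψ => .or (φ.subst σ) (ψ.subst σ)
  | .imp φ ψ => .imp (φ.subst σ) (ψ.subst σ)
  | .box φ => .box (φ.subst σ)
  | .dia φ => .dia (φ.subst σ)
  | .rhd φ ψ => .rhd (φ.subst σ) (ψ.subst σ)

/-- The conservativity logic `CL`: the smallest set of formulas containing all
classical tautologies, the distribution axiom, Löb's axiom and the axioms J1–J4,
closed under modus ponens, necessitation and uniform substitution. -/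
inductive CL : Fml → Prop
  | taut {φ} : Tautology φ → CL φ
  | axK (φ ψ) : CL (.imp (.box (.imp φ ψ)) (.imp (.box φ) (.box ψ)))
  | axLob (φ) : CL (.imp (.box (.imp (.box φ) φ)) (.box φ))
  | axJ1 (φ ψ) : CL (.imp (.box (.imp φ ψ)) (.rhd φ ψ))
  | axJ2 (φ ψ χ) : CL (.imp (.and (.rhd φ ψ) (.rhd ψ χ)) (.rhd φ χ))
  | axJ3 (φ ψ χ) : CL (.imp (.and (.rhd φ χ) (.rhd ψ χ)) (.rhd (.or φ ψ) χ))
  | axJ4 (φ ψ) : CL (.imp (.rhd φ ψ) (.imp (.dia φ) (.dia ψ)))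
  | mp {φ ψ} : CL (.imp φ ψ) → CL φ → CL ψ
  | nec {φ} : CL φ → CL (.box φ)
  | subst {φ} (σ : ℕ → Fml) : CL φ → CL (φ.subst σ)

/-- `L` is a normal extension of `CL`. -/
def NormalExt (L : Set Fml) : Prop :=
  (∀ φ, CL φ → φ ∈ L) ∧
    (∀ φ ψ : Fml, Fml.imp φ ψ ∈ L → φ ∈ L → ψ ∈ L) ∧
    (∀ φ : Fml, φ ∈ L → Fml.box φ ∈ L) ∧
    (∀ (φ : Fml) (σ : ℕ → Fml), φ ∈ L → φ.subst σ ∈ L)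

/-- A valuation on the bitopological space `⟨X, τ0, τ1⟩`. -/
structure BVal (X : Type) (τ0 τ1 : TopologicalSpace X) where
  v : Fml → Set X
  hbot : v .bot = ∅
  htop : v .top = Set.univ
  hneg : ∀ φ, v (.neg φ) = (v φ)ᶜ
  hand : ∀ φ ψ, v (.and φ ψ) = v φ ∩ v ψ
  hor : ∀ φ ψ, v (.or φ ψ) = v φ ∪ v ψ
  himp : ∀ φ ψ, v (.imp φ ψ) = (v φ)ᶜ ∪ v ψ
  hbox : ∀ φ, v (.box φ) = (dSet τ0 (v φ)ᶜ)ᶜ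
  hdia : ∀ φ, v (.dia φ) = dSet τ0 (v φ)
  hrhd : ∀ φ ψ, v (.rhd φ ψ) = eSet τ0 τ1 (v φ) (v ψ)

/-- A formula is valid in `⟨X, τ0, τ1⟩` if it is true everywhere under every valuation. -/
def Valid (X : Type) (τ0 τ1 : TopologicalSpace X) (φ : Fml) : Prop :=
  ∀ val : BVal X τ0 τ1, val.v φ = Set.univ

/-- `⟨X, τ0, τ1⟩` is an `L`-space if every formula of `L` is valid in it. -/
def IsLSpace (L : Set Fml) (X : Type) (τ0 τ1 : TopologicalSpace X) : Prop :=
  ∀ φ ∈ L, Valid X τ0 τ1 φ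

/-- The topological consequence relation `Γ ⊨_L^T φ`. -/
def TConseq (L : Set Fml) (Γ : Set Fml) (φ : Fml) : Prop :=
  ∀ (X : Type), Nonempty X → ∀ (τ0 τ1 : TopologicalSpace X),
    IsLSpace L X τ0 τ1 → ∀ (val : BVal X τ0 τ1) (x : X),
      (∀ ψ ∈ Γ, x ∈ val.v ψ) → x ∈ val.v φ

/-- `Γ ⊢_L φ`: some finite conjunction of members of `Γ` implies `φ` in `L`. -/
def Proves (L : Set Fml) (Γ : Set Fml) (φ : Fml) : Prop :=
  ∃ l : List Fml, (∀ ψ ∈ l, ψ ∈ Γ) ∧ Fml.imp (l.foldr Fml.and Fml.top) φ ∈ L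

/-- `L` is topologically complete. -/
def TopComplete (L : Set Fml) : Prop :=
  ∀ φ : Fml, TConseq L ∅ φ → φ ∈ L

/-- `L` is topologically strongly complete. -/
def TopStrongComplete (L : Set Fml) : Prop :=
  ∀ (Γ : Set Fml) (φ : Fml), TConseq L Γ φ → Proves L Γ φ

/-- The set defined by a formula under an assignment `a` of the variables. -/
def evalSet {X : Type} (τ0 τ1 : TopologicalSpace X) (a : ℕ → Set X) : Fml → Set X
  | .var n => a n
  | .top => Set.univ
  | .bot => ∅
  | .neg φ => (evalSet τ0 τ1 a φ)ᶜ
  | .and φ ψ => evalSet τ0 τ1 a φ ∩ evalSet τ0 τ1 a ψ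
  | .or φ ψ => evalSet τ0 τ1 a φ ∪ evalSet τ0 τ1 a ψ
  | .imp φ ψ => (evalSet τ0 τ1 a φ)ᶜ ∪ evalSet τ0 τ1 a ψ
  | .box φ => (dSet τ0 (evalSet τ0 τ1 a φ)ᶜ)ᶜ
  | .dia φ => dSet τ0 (evalSet τ0 τ1 a φ)
  | .rhd φ ψ => eSet τ0 τ1 (evalSet τ0 τ1 a φ) (evalSet τ0 τ1 a ψ)

/-- The valuation extending an assignment of the variables. -/
def BVal.ofAssignment {X : Type} (τ0 τ1 : TopologicalSpace X) (a : ℕ → Set X) :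
    BVal X τ0 τ1 where
  v := evalSet τ0 τ1 a
  hbot := rfl
  htop := rfl
  hneg _ := rfl
  hand _ _ := rfl
  hor _ _ := rfl
  himp _ _ := rfl
  hbox _ := rfl
  hdia _ := rfl
  hrhd _ _ := rfl

section Local

variable {X : Type} {τ0 τ1 : TopologicalSpace X}

theorem dSet_mono_s16 {A B : Set X} (h : A ⊆ B) : dSet τ0 A ⊆ dSet τ0 B := by
  intro y hy U hU hyU
  obtain ⟨z, hz, hzA, hzU⟩ := hy U hU hyU
  exact ⟨z, hz, h hzA, hzU⟩

theorem mem_dSet_of_local {P A B : Set X} {y : X} (hP : τ0.IsOpen P) (hy : y ∈ P)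
    (h : ∀ z ∈ P, z ≠ y → z ∈ A → z ∈ B) (hA : y ∈ dSet τ0 A) : y ∈ dSet τ0 B := by
  intro U hU hyU
  obtain ⟨z, hz, hzA, hzU, hzP⟩ := hA (U ∩ P) (τ0.isOpen_inter U P hU hP) ⟨hyU, hy⟩
  exact ⟨z, hz, h z hzP hz hzA, hzU⟩

/-- Membership in a derived set depends only on a punctured neighborhood. -/
theorem mem_dSet_congr {P A B : Set X} {y : X} (hP : τ0.IsOpen P) (hy : y ∈ P)
    (h : ∀ z ∈ P, z ≠ y → (z ∈ A ↔ z ∈ B)) : y ∈ dSet τ0 A ↔ y ∈ dSet τ0 B :=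
  ⟨mem_dSet_of_local hP hy fun z hz hne => (h z hz hne).1,
    mem_dSet_of_local hP hy fun z hz hne => (h z hz hne).2⟩

theorem mem_eSet_congr {P A A' B B' : Set X} {y : X} (hP : τ0.IsOpen P) (hy : y ∈ P)
    (hA : ∀ z ∈ P, z ≠ y → (z ∈ A ↔ z ∈ A')) (hB : ∀ z ∈ P, z ≠ y → (z ∈ B ↔ z ∈ B')) :
    y ∈ eSet τ0 τ1 A B ↔ y ∈ eSet τ0 τ1 A' B' := by
  refine forall₂_congr fun U _ => imp_congr ?_ ?_
  · exact mem_dSet_congr hP hy fun z hz hne => and_congr_left fun _ => hA z hz hne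
  · exact mem_dSet_congr hP hy fun z hz hne => and_congr_left fun _ => hB z hz hne

/-- Löb's axiom, read as a statement about derived sets. -/
theorem dSet_subset_dSet_diff {L : Set Fml} (hL : NormalExt L) (h : IsLSpace L X τ0 τ1)
    (A : Set X) : dSet τ0 A ⊆ dSet τ0 (A \ dSet τ0 A) := by
  intro y hy
  have hv := h _ (hL.1 _ (CL.axLob (.var 0))) (BVal.ofAssignment τ0 τ1 fun _ => Aᶜ)
  have hmem : y ∈ (BVal.ofAssignment τ0 τ1 fun _ => Aᶜ).v
      (.imp (.box (.imp (.box (.var 0)) (.var 0))) (.box (.var 0))) := hv ▸ Set.mem_univ y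
  simp only [BVal.ofAssignment, evalSet, compl_compl, Set.compl_union, Set.mem_union,
    Set.mem_compl_iff, hy, not_true_eq_false, or_false] at hmem
  rwa [Set.inter_comm, ← Set.sdiff_eq] at hmem

/-- In an `L`-space the topology `τ0` is `T_d`: every point is open in its closure. -/
theorem exists_isOpen_diff_singleton {L : Set Fml} (hL : NormalExt L)
    (h : IsLSpace L X τ0 τ1) (x : X) :
    ∃ O : Set X, τ0.IsOpen O ∧ x ∈ O ∧ τ0.IsOpen (O \ {x}) := by
  have hx : x ∉ dSet τ0 (dSet τ0 {x}) := by
    intro hx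
    have h1 : x ∈ dSet τ0 ({x} ∪ dSet τ0 {x}) := dSet_mono_s16 Set.subset_union_right hx
    obtain ⟨y, -, ⟨hy, hy'⟩, -⟩ :=
      dSet_subset_dSet_diff hL h _ h1 Set.univ τ0.isOpen_univ trivial
    rcases hy with rfl | hy
    · exact hy' h1
    · exact hy' (dSet_mono_s16 Set.subset_union_left hy)
  simp only [dSet, Set.mem_ofPred_eq, not_forall] at hx
  obtain ⟨O, hO, hxO, hd⟩ := hx
  refine ⟨O, hO, hxO, ?_⟩
  refine (@isOpen_iff_forall_mem_open X τ0 _).2 fun y hy => ?_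
  by_contra hcon
  refine hd ⟨y, hy.2, fun U hU hyU => ?_, hy.1⟩
  by_contra hU'
  refine hcon ⟨U ∩ O, fun z hz => ⟨hz.2, fun hzx => hU' ?_⟩, τ0.isOpen_inter U O hU hO,
    hyU, hy.1⟩
  rw [Set.mem_singleton_iff] at hzx
  exact ⟨x, fun hxy => hy.2 hxy.symm, rfl, hzx ▸ hz.1⟩

end Local

section Bouquet

variable {ι : Type} (F : Ultrafilter ι) {Y : ι → Type}

/-- The inclusion of a summand into the bouquet, whose base point is `none`. -/
def petal (i : ι) (y : Y i) : Option (Σ i, Y i) := some ⟨i, y⟩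

/-- The first topology of the ultrabouquet of the pointed spaces `(Y i, x i)`: the traces of an
open neighborhood of `none` are, for `F`-almost all `i`, punctured neighborhoods of `x i`. -/
abbrev bouquetTop (τ : ∀ i, TopologicalSpace (Y i)) (x : ∀ i, Y i) :
    TopologicalSpace (Option (Σ i, Y i)) where
  IsOpen U := (∀ i, (τ i).IsOpen (petal i ⁻¹' U)) ∧
    (none ∈ U → ∀ᶠ i in F, (τ i).IsOpen (insert (x i) (petal i ⁻¹' U)))
  isOpen_univ := ⟨fun i => (τ i).isOpen_univ, fun _ => .of_forall fun i => by
    simpa using (τ i).isOpen_univ⟩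
  isOpen_inter U V hU hV := by
    refine ⟨fun i => (τ i).isOpen_inter _ _ (hU.1 i) (hV.1 i), fun h => ?_⟩
    filter_upwards [hU.2 h.1, hV.2 h.2] with i h1 h2
    rw [Set.preimage_inter, Set.insert_inter_distrib]
    exact (τ i).isOpen_inter _ _ h1 h2
  isOpen_sUnion S hS := by
    have hopen (i : ι) : (τ i).IsOpen (petal i ⁻¹' ⋃₀ S) := by
      rw [Set.sUnion_eq_biUnion, Set.preimage_iUnion₂]
      exact @isOpen_biUnion _ _ (τ i) _ _ fun U hU => (hS U hU).1 i
    refine ⟨hopen, ?_⟩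
    rintro ⟨U, hU, hn⟩
    filter_upwards [(hS U hU).2 hn] with i hi
    have hsub : insert (x i) (petal i ⁻¹' ⋃₀ S)
        = insert (x i) (petal i ⁻¹' U) ∪ petal i ⁻¹' ⋃₀ S := by
      rw [Set.insert_union, Set.union_eq_right.2]
      exact Set.preimage_mono (Set.subset_sUnion_of_mem hU)
    rw [hsub]
    exact @IsOpen.union _ _ _ (τ i) hi (hopen i)

/-- The second topology of the ultrabouquet. -/
abbrev sumTop (τ : ∀ i, TopologicalSpace (Y i)) : TopologicalSpace (Option (Σ i, Y i)) :=
  ⨆ i, (τ i).coinduced (petal i)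

theorem isOpen_sumTop {τ : ∀ i, TopologicalSpace (Y i)} {U : Set (Option (Σ i, Y i))} :
    (sumTop τ).IsOpen U ↔ ∀ i, (τ i).IsOpen (petal i ⁻¹' U) :=
  isOpen_iSup_iff

/-- The union of a family of subsets of the summands. -/
def glue (V : ∀ i, Set (Y i)) : Set (Option (Σ i, Y i)) := {z | ∃ i, ∃ y ∈ V i, petal i y = z}

theorem petal_injective (i : ι) : Function.Injective (petal (Y := Y) i) := by
  intro y z h
  simpa [petal] using h

theorem petal_preimage_glue (V : ∀ i, Set (Y i)) (i : ι) : petal i ⁻¹' glue V = V i := by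
  ext y
  constructor
  · rintro ⟨j, z, hz, h⟩
    cases h
    exact hz
  · exact fun hy => ⟨i, y, hy, rfl⟩

theorem none_notMem_glue (V : ∀ i, Set (Y i)) : none ∉ glue V := by
  rintro ⟨_, _, _, h⟩
  cases h

theorem exists_petal_preimage_eq (τ : ∀ i, TopologicalSpace (Y i)) {i : ι} {U : Set (Y i)}
    (hU : (τ i).IsOpen U) : ∃ V : Set (Option (Σ i, Y i)), (∀ j, (τ j).IsOpen (petal j ⁻¹' V)) ∧
      none ∉ V ∧ petal i ⁻¹' V = U ∧ V ⊆ Set.range (petal i) := by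
  classical
  refine ⟨petal i '' U, fun j => ?_, ?_, ?_, Set.image_subset_range _ _⟩
  · by_cases hij : i = j
    · subst hij
      rwa [(petal_injective i).preimage_image]
    · have hempty : petal j ⁻¹' (petal i '' U) = ∅ := by
        refine Set.eq_empty_of_forall_notMem fun y => ?_
        rintro ⟨z, -, hz⟩
        cases hz
        exact hij rfl
      rw [hempty]
      exact @isOpen_empty _ (τ j)
  · rintro ⟨_, _, h⟩
    cases h
  · exact (petal_injective i).preimage_image U

variable {τ0 τ1 : ∀ i, TopologicalSpace (Y i)} {x : ∀ i, Y i}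

theorem petal_mem_dSet {A : Set (Option (Σ i, Y i))} {i : ι} {y : Y i} :
    petal i y ∈ dSet (bouquetTop F τ0 x) A ↔ y ∈ dSet (τ0 i) (petal i ⁻¹' A) := by
  constructor
  · intro h U hU hy
    obtain ⟨V, hV, hn, rfl, hr⟩ := exists_petal_preimage_eq τ0 hU
    obtain ⟨z, hz, hzA, hzV⟩ := h V ⟨hV, fun h => absurd h hn⟩ hy
    obtain ⟨z, rfl⟩ := hr hzV
    exact ⟨z, fun h => hz (h ▸ rfl), hzA, hzV⟩
  · intro h U hU hy
    obtain ⟨z, hz, hzA, hzU⟩ := h _ (hU.1 i) hy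
    exact ⟨petal i z, fun h => hz (petal_injective i h), hzA, hzU⟩

theorem petal_mem_eSet {A B : Set (Option (Σ i, Y i))} {i : ι} {y : Y i} :
    petal i y ∈ eSet (bouquetTop F τ0 x) (sumTop τ1) A B ↔
      y ∈ eSet (τ0 i) (τ1 i) (petal i ⁻¹' A) (petal i ⁻¹' B) := by
  simp only [eSet, Set.mem_ofPred_eq, petal_mem_dSet, isOpen_sumTop, Set.preimage_inter]
  constructor
  · intro h U hU
    obtain ⟨V, hV, -, rfl, -⟩ := exists_petal_preimage_eq τ1 hU
    exact h V hV
  · exact fun h U hU => h _ (hU i)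

theorem none_mem_dSet {O : ∀ i, Set (Y i)} (hO : ∀ i, (τ0 i).IsOpen (O i))
    (hx : ∀ i, x i ∈ O i) (hO' : ∀ i, (τ0 i).IsOpen (O i \ {x i}))
    {A : Set (Option (Σ i, Y i))} :
    none ∈ dSet (bouquetTop F τ0 x) A ↔ ∀ᶠ i in F, x i ∈ dSet (τ0 i) (petal i ⁻¹' A) := by
  constructor
  · intro h
    by_contra hcon
    rw [← Ultrafilter.eventually_not] at hcon
    classical
    have hV (i : ι) : ∃ V : Set (Y i), (τ0 i).IsOpen V ∧ Disjoint V (petal i ⁻¹' A) ∧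
        (x i ∉ dSet (τ0 i) (petal i ⁻¹' A) → (τ0 i).IsOpen (insert (x i) V)) := by
      by_cases hi : x i ∈ dSet (τ0 i) (petal i ⁻¹' A)
      · exact ⟨∅, @isOpen_empty _ (τ0 i), Set.empty_disjoint _, fun h => absurd hi h⟩
      · simp only [dSet, Set.mem_ofPred_eq, not_forall] at hi
        obtain ⟨U, hU, hxU, hne⟩ := hi
        refine ⟨U ∩ (O i \ {x i}), (τ0 i).isOpen_inter _ _ hU (hO' i),
          Set.disjoint_left.2 fun z hz hzA => hne ⟨z, hz.2.2, hzA, hz.1⟩, fun _ => ?_⟩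
        have hins : insert (x i) (U ∩ (O i \ {x i})) = U ∩ O i := by
          ext z
          by_cases hz : z = x i
          · simp [hz, hxU, hx i]
          · simp [hz]
        rw [hins]
        exact (τ0 i).isOpen_inter _ _ hU (hO i)
    choose V hV hVA hVx using hV
    have hpre (i : ι) : petal i ⁻¹' insert none (glue V) = V i := by
      rw [← petal_preimage_glue V i]
      ext y
      exact or_iff_right (by simp [petal])
    obtain ⟨z, hz, hzA, hzV⟩ := h (insert none (glue V))
      ⟨fun i => hpre i ▸ hV i, fun _ => hcon.mono fun i hi => (hpre i).symm ▸ hVx i hi⟩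
      (Set.mem_insert _ _)
    obtain ⟨i, y, hy, rfl⟩ := hzV.resolve_left hz
    exact Set.disjoint_left.1 (hVA i) hy hzA
  · intro h U hU hn
    obtain ⟨i, hi, hiU⟩ := (h.and (hU.2 hn)).exists
    obtain ⟨z, hz, hzA, hzU⟩ := hi _ hiU (Set.mem_insert _ _)
    exact ⟨petal i z, nofun, hzA, hzU.resolve_left hz⟩

theorem none_mem_eSet {O : ∀ i, Set (Y i)} (hO : ∀ i, (τ0 i).IsOpen (O i))
    (hx : ∀ i, x i ∈ O i) (hO' : ∀ i, (τ0 i).IsOpen (O i \ {x i}))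
    {A B : Set (Option (Σ i, Y i))} :
    none ∈ eSet (bouquetTop F τ0 x) (sumTop τ1) A B ↔
      ∀ᶠ i in F, x i ∈ eSet (τ0 i) (τ1 i) (petal i ⁻¹' A) (petal i ⁻¹' B) := by
  have hd {A : Set (Option (Σ i, Y i))} := none_mem_dSet F hO hx hO' (A := A)
  constructor
  · intro h
    by_contra hcon
    rw [← Ultrafilter.eventually_not] at hcon
    have hU (i : ι) : ∃ U : Set (Y i), (τ1 i).IsOpen U ∧
        (x i ∉ eSet (τ0 i) (τ1 i) (petal i ⁻¹' A) (petal i ⁻¹' B) →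
          x i ∈ dSet (τ0 i) (petal i ⁻¹' A ∩ U) ∧ x i ∉ dSet (τ0 i) (petal i ⁻¹' B ∩ U)) := by
      by_cases hi : x i ∈ eSet (τ0 i) (τ1 i) (petal i ⁻¹' A) (petal i ⁻¹' B)
      · exact ⟨∅, @isOpen_empty _ (τ1 i), fun h => absurd hi h⟩
      · have hi' := hi
        simp only [eSet, Set.mem_ofPred_eq, not_forall] at hi'
        obtain ⟨U, hU, hA, hB⟩ := hi'
        exact ⟨U, hU, fun _ => ⟨hA, hB⟩⟩
    choose U hU hUx using hU
    have hB := h (glue U) (isOpen_sumTop.2 fun i => (petal_preimage_glue U i).symm ▸ hU i)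
      (hd.2 (hcon.mono fun i hi => by
        rw [Set.preimage_inter, petal_preimage_glue]
        exact (hUx i hi).1))
    obtain ⟨i, hi, hiB⟩ := (hcon.and (hd.1 hB)).exists
    rw [Set.preimage_inter, petal_preimage_glue] at hiB
    exact (hUx i hi).2 hiB
  · intro h U hU hA
    rw [hd] at hA ⊢
    filter_upwards [h, hA] with i hi hiA
    exact hi _ (isOpen_sumTop.1 hU i) hiA

/-- Truth at the points of an open subset of a summand only depends on the assignment there. -/
theorem petal_mem_val {i : ι} {P : Set (Y i)} (hP : (τ0 i).IsOpen P)
    (val : BVal _ (bouquetTop F τ0 x) (sumTop τ1)) (w : BVal (Y i) (τ0 i) (τ1 i))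
    (h : ∀ n, ∀ y ∈ P, petal i y ∈ val.v (.var n) ↔ y ∈ w.v (.var n)) (φ : Fml) :
    ∀ y ∈ P, petal i y ∈ val.v φ ↔ y ∈ w.v φ := by
  induction φ with
  | var n => exact h n
  | top => simp [val.htop, w.htop]
  | bot => simp [val.hbot, w.hbot]
  | neg φ ih => exact fun y hy => by simp [val.hneg, w.hneg, ih y hy]
  | and φ ψ ih1 ih2 => exact fun y hy => by simp [val.hand, w.hand, ih1 y hy, ih2 y hy]
  | or φ ψ ih1 ih2 => exact fun y hy => by simp [val.hor, w.hor, ih1 y hy, ih2 y hy]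
  | imp φ ψ ih1 ih2 => exact fun y hy => by simp [val.himp, w.himp, ih1 y hy, ih2 y hy]
  | box φ ih =>
    intro y hy
    rw [val.hbox, w.hbox, Set.mem_compl_iff, Set.mem_compl_iff, petal_mem_dSet]
    exact not_congr (mem_dSet_congr hP hy fun z hz _ => not_congr (ih z hz))
  | dia φ ih =>
    intro y hy
    rw [val.hdia, w.hdia, petal_mem_dSet]
    exact mem_dSet_congr hP hy fun z hz _ => ih z hz
  | rhd φ ψ ih1 ih2 =>
    intro y hy
    rw [val.hrhd, w.hrhd, petal_mem_eSet]
    exact mem_eSet_congr hP hy (fun z hz _ => ih1 z hz) fun z hz _ => ih2 z hz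

/-- A version of Łoś's theorem: truth at the base point is truth at almost all `x i`. -/
theorem none_mem_val {O : ∀ i, Set (Y i)} (hO : ∀ i, (τ0 i).IsOpen (O i))
    (hx : ∀ i, x i ∈ O i) (hO' : ∀ i, (τ0 i).IsOpen (O i \ {x i}))
    (val : BVal _ (bouquetTop F τ0 x) (sumTop τ1)) (w : ∀ i, BVal (Y i) (τ0 i) (τ1 i))
    (h : ∀ n i, ∀ y ∈ O i \ {x i}, petal i y ∈ val.v (.var n) ↔ y ∈ (w i).v (.var n))
    (h0 : ∀ n, none ∈ val.v (.var n) ↔ ∀ᶠ i in F, x i ∈ (w i).v (.var n)) (φ : Fml) :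
    none ∈ val.v φ ↔ ∀ᶠ i in F, x i ∈ (w i).v φ := by
  have hloc (φ : Fml) (i : ι) (z : Y i) (hz : z ∈ O i) (hne : z ≠ x i) :
      z ∈ petal i ⁻¹' val.v φ ↔ z ∈ (w i).v φ :=
    petal_mem_val F (hO' i) val (w i) (fun n => h n i) φ z ⟨hz, hne⟩
  induction φ with
  | var n => exact h0 n
  | top => simp [val.htop, BVal.htop]
  | bot => simp [val.hbot, BVal.hbot, F.neBot.ne]
  | neg φ ih => simp only [val.hneg, BVal.hneg, Set.mem_compl_iff, ih, Ultrafilter.eventually_not]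
  | and φ ψ ih1 ih2 => simp [val.hand, BVal.hand, ih1, ih2, Filter.eventually_and]
  | or φ ψ ih1 ih2 => simp [val.hor, BVal.hor, ih1, ih2, Ultrafilter.eventually_or]
  | imp φ ψ ih1 ih2 =>
    simp only [val.himp, BVal.himp, Set.mem_union, Set.mem_compl_iff, ih1, ih2,
      Ultrafilter.eventually_or, Ultrafilter.eventually_not]
  | box φ ih =>
    simp only [val.hbox, BVal.hbox, Set.mem_compl_iff, none_mem_dSet F hO hx hO',
      Ultrafilter.eventually_not]
    refine not_congr (Filter.eventually_congr (.of_forall fun i => ?_))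
    exact mem_dSet_congr (hO i) (hx i) fun z hz hne => not_congr (hloc φ i z hz hne)
  | dia φ ih =>
    simp only [val.hdia, BVal.hdia, none_mem_dSet F hO hx hO']
    refine Filter.eventually_congr (.of_forall fun i => ?_)
    exact mem_dSet_congr (hO i) (hx i) (hloc φ i)
  | rhd φ ψ ih1 ih2 =>
    simp only [val.hrhd, BVal.hrhd, none_mem_eSet F hO hx hO']
    refine Filter.eventually_congr (.of_forall fun i => ?_)
    exact mem_eSet_congr (hO i) (hx i) (hloc φ i) (hloc ψ i)

/-- Ultrabouquets of `L`-spaces are `L`-spaces. -/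
theorem isLSpace_bouquet {L : Set Fml} (h : ∀ i, IsLSpace L (Y i) (τ0 i) (τ1 i))
    {O : ∀ i, Set (Y i)} (hO : ∀ i, (τ0 i).IsOpen (O i))
    (hx : ∀ i, x i ∈ O i) (hO' : ∀ i, (τ0 i).IsOpen (O i \ {x i})) :
    IsLSpace L _ (bouquetTop F τ0 x) (sumTop τ1) := by
  intro φ hφ val
  refine Set.eq_univ_of_forall fun z => ?_
  rcases z with _ | ⟨i, y⟩
  · let w (i : ι) : BVal (Y i) (τ0 i) (τ1 i) := .ofAssignment _ _ fun n =>
      {y | (y = x i ∧ none ∈ val.v (.var n)) ∨ (y ≠ x i ∧ petal i y ∈ val.v (.var n))}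
    refine (none_mem_val F hO hx hO' val w ?_ ?_ φ).2 (.of_forall fun i => ?_)
    · rintro n i y ⟨-, hy⟩
      have hy : y ≠ x i := hy
      simp [w, BVal.ofAssignment, evalSet, hy]
    · intro n
      simp [w, BVal.ofAssignment, evalSet]
    · exact h i φ hφ (w i) ▸ Set.mem_univ _
  · let w : BVal (Y i) (τ0 i) (τ1 i) := .ofAssignment _ _ fun n => petal i ⁻¹' val.v (.var n)
    refine (petal_mem_val F (τ0 i).isOpen_univ val w (fun _ _ _ => Iff.rfl) φ y trivial).2 ?_
    exact h i φ hφ w ▸ Set.mem_univ _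

end Bouquet

theorem BVal.mem_foldr_and {X : Type} {τ0 τ1 : TopologicalSpace X} (val : BVal X τ0 τ1) (x : X)
    (l : List Fml) : x ∈ val.v (l.foldr Fml.and Fml.top) ↔ ∀ ψ ∈ l, x ∈ val.v ψ := by
  induction l with
  | nil => simp [val.htop]
  | cons ψ l ih => simp [val.hand, ih]


/-- A normal extension of `CL` is topologically complete iff it is topologically
strongly complete. -/
theorem topComplete_iff_topStrongComplete (L : Set Fml) (hL : NormalExt L) :
    TopComplete L ↔ TopStrongComplete L := by
  classical
  constructor
  · intro hc Γ φ hΓ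
    by_contra hnot
    have hfin (s : Finset Γ) : ∃ (X : Type) (τ0 τ1 : TopologicalSpace X),
        IsLSpace L X τ0 τ1 ∧ ∃ (val : BVal X τ0 τ1) (x : X),
          (∀ ψ ∈ s, x ∈ val.v ψ) ∧ x ∉ val.v φ := by
      by_contra hs
      refine hnot ⟨s.toList.map Subtype.val, ?_, hc _ fun X _ τ0 τ1 hX val x _ => ?_⟩
      · intro ψ hψ
        obtain ⟨χ, -, rfl⟩ := List.mem_map.1 hψ
        exact χ.2
      by_contra hx
      simp only [val.himp, Set.mem_union, Set.mem_compl_iff, not_or, not_not,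
        val.mem_foldr_and] at hx
      exact hs ⟨X, τ0, τ1, hX, val, x,
        fun ψ hψ => hx.1 _ (List.mem_map_of_mem (Finset.mem_toList.2 hψ)), hx.2⟩
    choose Y τ0 τ1 hY w x hx hxφ using hfin
    choose O hO hxO hO' using fun s => exists_isOpen_diff_singleton hL (hY s) (x s)
    let F : Ultrafilter (Finset Γ) := .of Filter.atTop
    let val : BVal _ (bouquetTop F τ0 x) (sumTop τ1) := .ofAssignment _ _ fun n =>
      {z | match z with
        | none => ∀ᶠ s in F, x s ∈ (w s).v (.var n)
        | some ⟨s, y⟩ => y ∈ (w s).v (.var n)}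
    have key := none_mem_val F hO hxO hO' val w (fun _ _ _ _ => Iff.rfl) fun _ => Iff.rfl
    have hφ := (key φ).1 (hΓ _ ⟨none⟩ _ _ (isLSpace_bouquet F hY hO hxO hO') val none
      fun ψ hψ => (key ψ).2 ?_)
    · obtain ⟨s, hs⟩ := hφ.exists
      exact hxφ s hs
    · refine Ultrafilter.of_le _ ((Filter.eventually_ge_atTop {⟨ψ, hψ⟩}).mono fun s hs => ?_)
      exact hx s ⟨ψ, hψ⟩ (Finset.singleton_subset_iff.1 hs)
  · intro hs φ hφ
    obtain ⟨l, hl, h⟩ := hs ∅ φ hφ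
    obtain rfl : l = [] := List.eq_nil_iff_forall_not_mem.2 hl
    exact hL.2.1 _ _ h (hL.1 _ (.taut fun _ => rfl))
end

section
/- Let ⟨W, R, S, ⊩⟩ be a Visser model, and let τ_R and τ_S be the topologies on W of R-upward closed and S-upward closed sets respectively. Let v be a valuation on the bitopological space ⟨W, τ_R, τ_S⟩ such that v(p) = {x ∈ W | x ⊩ p} for every propositional variable p. Then v(φ) = {x ∈ W | x ⊩ φ} for every L(□,▷)-formula φ. -/
/-- The topology of `P`-upward closed subsets. -/
def upTop {W : Type} (P : W → W → Prop) : TopologicalSpace W where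
  IsOpen U := ∀ x ∈ U, ∀ y, P x y → y ∈ U
  isOpen_univ := by intro x _ y _; trivial
  isOpen_inter := by
    intro U V hU hV x hx y hxy
    exact ⟨hU x hx.1 y hxy, hV x hx.2 y hxy⟩
  isOpen_sUnion := by
    intro S hS x hx y hxy
    obtain ⟨U, hU, hxU⟩ := hx
    exact ⟨U, hU, hS U hU x hxU y hxy⟩

theorem mem_dSet_upTop {W : Type} {R : W → W → Prop} (htrans : Transitive R)
    (hirr : ∀ x, ¬ R x x) {Y : Set W} {x : W} :
    x ∈ dSet (upTop R) Y ↔ ∃ y, R x y ∧ y ∈ Y := by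
  constructor
  · intro h
    have hopen : (upTop R).IsOpen {y | y = x ∨ R x y} := by
      rintro a (rfl | ha) b hab
      · exact Or.inr hab
      · exact Or.inr (htrans ha hab)
    obtain ⟨y, hne, hyY, rfl | hxy⟩ := h _ hopen (Or.inl rfl)
    · exact absurd rfl hne
    · exact ⟨y, hxy, hyY⟩
  · rintro ⟨y, hxy, hy⟩ U hU hxU
    exact ⟨y, fun h => hirr x (h ▸ hxy), hy, hU x hxU y hxy⟩

theorem mem_eSet_upTop {W : Type} {R S : W → W → Prop} (hRtrans : Transitive R)
    (hirr : ∀ x, ¬ R x x) (hSrefl : ∀ x, S x x) (hStrans : Transitive S)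
    {Y Z : Set W} {x : W} :
    x ∈ eSet (upTop R) (upTop S) Y Z ↔
      ∀ y, R x y → y ∈ Y → ∃ z, R x z ∧ S y z ∧ z ∈ Z := by
  constructor
  · intro h y hxy hy
    have hopen : (upTop S).IsOpen {z | S y z} := fun _ ha _ hab => hStrans ha hab
    obtain ⟨z, hxz, hz, hyz⟩ := (mem_dSet_upTop hRtrans hirr).1
      (h _ hopen ((mem_dSet_upTop hRtrans hirr).2 ⟨y, hxy, hy, hSrefl y⟩))
    exact ⟨z, hxz, hyz, hz⟩
  · intro h U hU hx
    obtain ⟨y, hxy, hy, hyU⟩ := (mem_dSet_upTop hRtrans hirr).1 hx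
    obtain ⟨z, hxz, hyz, hz⟩ := h y hxy hy
    exact (mem_dSet_upTop hRtrans hirr).2 ⟨z, hxz, hz, hU y hyU z hyz⟩

/-- On a Visser model `⟨W, R, S, ⊩⟩`, any valuation on the bitopological space
`⟨W, τ_R, τ_S⟩` agreeing with `⊩` on propositional variables agrees with `⊩` on
all formulas. -/
theorem visser_model_bitop_agreement {W : Type} (hW : Nonempty W)
    (R S : W → W → Prop)
    (hRtrans : Transitive R) (hRcwf : WellFounded (fun a b => R b a))
    (hSrefl : ∀ x, S x x) (hStrans : Transitive S)
    (frc : W → Fml → Prop)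
    (hbot : ∀ x, ¬ frc x Fml.bot)
    (htop : ∀ x, frc x Fml.top)
    (hneg : ∀ x φ, frc x (Fml.neg φ) ↔ ¬ frc x φ)
    (hand : ∀ x φ ψ, frc x (Fml.and φ ψ) ↔ frc x φ ∧ frc x ψ)
    (hor : ∀ x φ ψ, frc x (Fml.or φ ψ) ↔ frc x φ ∨ frc x ψ)
    (himp : ∀ x φ ψ, frc x (Fml.imp φ ψ) ↔ (frc x φ → frc x ψ))
    (hbox : ∀ x φ, frc x (Fml.box φ) ↔ ∀ y, R x y → frc y φ)
    (hdia : ∀ x φ, frc x (Fml.dia φ) ↔ ∃ y, R x y ∧ frc y φ)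
    (hrhd : ∀ x φ ψ, frc x (Fml.rhd φ ψ) ↔
      ∀ y, R x y → frc y φ → ∃ z, R x z ∧ S y z ∧ frc z ψ)
    (val : BVal W (upTop R) (upTop S))
    (hvar : ∀ n : ℕ, val.v (Fml.var n) = {x | frc x (Fml.var n)}) :
    ∀ φ : Fml, val.v φ = {x | frc x φ} := by
  have hirr : ∀ x, ¬ R x x := fun x => hRcwf.irrefl.irrefl x
  intro φ
  induction φ with
  | var n => exact hvar n
  | top => ext x; simp [val.htop, htop]
  | bot => ext x; simp [val.hbot, hbot]
  | neg φ ih => ext x; simp [val.hneg, ih, hneg]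
  | and φ ψ ihφ ihψ => ext x; simp [val.hand, ihφ, ihψ, hand]
  | or φ ψ ihφ ihψ => ext x; simp [val.hor, ihφ, ihψ, hor]
  | imp φ ψ ihφ ihψ => ext x; simp [val.himp, ihφ, ihψ, himp, imp_iff_not_or]
  | box φ ih => ext x; simp [val.hbox, ih, hbox, mem_dSet_upTop hRtrans hirr]
  | dia φ ih => ext x; simp [val.hdia, ih, hdia, mem_dSet_upTop hRtrans hirr]
  | rhd φ ψ ihφ ihψ =>
    ext x
    simp [val.hrhd, ihφ, ihψ, hrhd, mem_eSet_upTop hRtrans hirr hSrefl hStrans]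
end
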